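/- Let Λ be a well-founded partially ordered set and let A be a ring equipped with a prestandard filter over a family of rings {B_λ}_{λ∈Λ}, with data {A^{≤λ}}, {B'_λ ⊆ B_λ}, and Morita contexts (M_λ, N_λ, η_λ, ρ_λ) between A/A^{<λ} and B_λ/B'_λ as in the definition; let B''_λ ⊆ B_λ be the preimage of im(ρ_λ) under the quotient map B_λ → B_λ/B'_λ. Then there is a bijection between the set of isomorphism classes of simple left A-modules and the disjoint union over λ ∈ Λ of the sets of isomorphism classes of simple left B_λ-modules W with B'_λ·W = 0 and B''_λ·W = W; it sends the class of a pair (λ, W) to the class of D_λ W := the image of the (A/A^{<λ})-linear map M_λ ⊗_{B_λ/B'_λ} W → Hom_{B_λ/B'_λ}(N_λ, W), m ⊗ w ↦ (n ↦ ρ_λ(n ⊗ m)·w), regarded as a left A-module via A → A/A^{<λ}. -/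

import Mathlib

open MulOpposite

universe u v

section HomModule

variable {R S : Type u} [Ring R] [Ring S]
  {X : Type u} [AddCommGroup X] [Module S X] [Module Rᵐᵒᵖ X] [SMulCommClass S Rᵐᵒᵖ X]
  (W : Type u) [AddCommGroup W] [Module S W]

/-- For an `(S, R)`-bimodule `X` and a left `S`-module `W`, the hom-module
`Hom_S(X, W)` is a left `R`-module via the right `R`-action on `X`:
`(r • ψ) x = ψ (x · r)`. -/
instance instSMulHomDom : SMul R (X →ₗ[S] W) :=
  ⟨fun r ψ =>
    { toFun := fun x => ψ (op r • x)
      map_add' := fun x y => by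
        show ψ (op r • (x + y)) = ψ (op r • x) + ψ (op r • y)
        rw [smul_add, map_add]
      map_smul' := fun s x => by
        show ψ (op r • (s • x)) = s • ψ (op r • x)
        rw [← smul_comm, map_smul] }⟩

theorem domSMul_apply (r : R) (ψ : X →ₗ[S] W) (x : X) : (r • ψ) x = ψ (op r • x) := rfl

instance instModuleHomDom : Module R (X →ₗ[S] W) where
  one_smul ψ := by ext x; simp [domSMul_apply]
  mul_smul r r' ψ := by ext x; simp [domSMul_apply, op_mul, mul_smul]
  smul_zero r := by ext x; simp [domSMul_apply]
  smul_add r ψ φ := by ext x; simp [domSMul_apply]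
  add_smul r r' ψ := by ext x; simp [domSMul_apply, op_add, add_smul]
  zero_smul ψ := by ext x; simp [domSMul_apply]

end HomModule

section StandardFilter

variable {Λ : Type v} [PartialOrder Λ]
variable (A : Type u) [Ring A]
variable (B : Λ → Type u) [∀ l, Ring (B l)]
variable (M N : Λ → Type u)
variable [∀ l, AddCommGroup (M l)] [∀ l, AddCommGroup (N l)]
variable [∀ l, Module A (M l)] [∀ l, Module (B l)ᵐᵒᵖ (M l)]
variable [∀ l, SMulCommClass A (B l)ᵐᵒᵖ (M l)]
variable [∀ l, Module (B l) (N l)] [∀ l, Module Aᵐᵒᵖ (N l)]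
variable [∀ l, SMulCommClass (B l) Aᵐᵒᵖ (N l)]

/-- `A^{<λ} = ∑_{μ < λ} A^{≤μ}`. -/
def lessIdeal (F : Λ → Ideal A) (l : Λ) : Ideal A := ⨆ m ∈ {m : Λ | m < l}, F m

variable {A B M N}

/-- For a left `B_λ`-module `W`, the module `D_λ W`: the image of the
`(A/A^{<λ})`-linear map `M_λ ⊗_{B_λ/B'_λ} W → Hom_{B_λ/B'_λ}(N_λ, W)`,
`m ⊗ w ↦ (n ↦ ρ_λ(n ⊗ m) • w)`, regarded as a left `A`-module via `A → A/A^{<λ}`. -/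
def Dmod (B' : ∀ l, Ideal (B l)) (rho : ∀ l, N l → M l → B l ⧸ B' l) (l : Λ)
    (W : Type u) [AddCommGroup W] [Module (B l) W] : Submodule A (N l →ₗ[B l] W) :=
  Submodule.span A {ψ : N l →ₗ[B l] W | ∃ (m : M l) (w : W),
    ∀ (n : N l) (b : B l), Submodule.Quotient.mk b = rho l n m → ψ n = b • w}

/-- `B'_λ • W = 0`. -/
def BAnn (B' : ∀ l, Ideal (B l)) (l : Λ) (W : Type u) [AddCommGroup W]
    [Module (B l) W] : Prop :=
  ∀ b ∈ B' l, ∀ w : W, b • w = 0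

/-- `B''_λ • W = W`, where `B''_λ ⊆ B_λ` is the preimage of the trace ideal
`im ρ_λ ⊆ B_λ/B'_λ` under the quotient map. -/
def BFull (B' : ∀ l, Ideal (B l)) (rho : ∀ l, N l → M l → B l ⧸ B' l) (l : Λ)
    (W : Type u) [AddCommGroup W] [Module (B l) W] : Prop :=
  Submodule.span (B l) {x : W | ∃ b : B l,
    (Submodule.Quotient.mk b ∈
      Submodule.span (B l) {y : B l ⧸ B' l | ∃ (n : N l) (m : M l), y = rho l n m}) ∧
    ∃ w : W, x = b • w} = ⊤

/-- Isomorphism classes of simple left `A`-modules. -/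
def setoidA : Setoid {V : ModuleCat.{u} A // IsSimpleModule A V} where
  r V V' := Nonempty (↥V.1 ≃ₗ[A] ↥V'.1)
  iseqv := ⟨fun _ => ⟨LinearEquiv.refl _ _⟩, fun ⟨e⟩ => ⟨e.symm⟩, fun ⟨e⟩ ⟨f⟩ => ⟨e.trans f⟩⟩

/-- Isomorphism classes of simple left `B_λ`-modules `W` with `B'_λ•W = 0` and
`B''_λ•W = W`. -/
def setoidB (B' : ∀ l, Ideal (B l)) (rho : ∀ l, N l → M l → B l ⧸ B' l) (l : Λ) :
    Setoid {W : ModuleCat.{u} (B l) //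
      IsSimpleModule (B l) W ∧ BAnn B' l W ∧ BFull B' rho l W} where
  r W W' := Nonempty (↥W.1 ≃ₗ[B l] ↥W'.1)
  iseqv := ⟨fun _ => ⟨LinearEquiv.refl _ _⟩, fun ⟨e⟩ => ⟨e.symm⟩, fun ⟨e⟩ ⟨f⟩ => ⟨e.trans f⟩⟩

section MoritaHelpers

variable {R S X Y : Type u} [Ring R] [Ring S] [AddCommGroup X] [AddCommGroup Y]
  [Module R X] [Module Sᵐᵒᵖ X] [SMulCommClass R Sᵐᵒᵖ X]
  [Module S Y] [Module Rᵐᵒᵖ Y] [SMulCommClass S Rᵐᵒᵖ Y]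

/-- A Morita context over quotient rings, expressed on representatives. -/
structure MCtx (I : Ideal R) (J : Ideal S) (eta : X → Y → R ⧸ I) (rho : Y → X → S ⧸ J) :
    Prop where
  Xann : ∀ a ∈ I, ∀ x : X, a • x = 0
  Yann : ∀ a ∈ I, ∀ y : Y, op a • y = 0
  XannS : ∀ b ∈ J, ∀ x : X, op b • x = 0
  YannS : ∀ b ∈ J, ∀ y : Y, b • y = 0
  eta_add_left : ∀ (m m' : X) (n : Y), eta (m + m') n = eta m n + eta m' n
  eta_add_right : ∀ (m : X) (n n' : Y), eta m (n + n') = eta m n + eta m n'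
  eta_smul_left : ∀ (a : R) (m : X) (n : Y), eta (a • m) n = a • eta m n
  eta_smul_right : ∀ (a : R) (m : X) (n : Y) (x : R),
      Submodule.Quotient.mk x = eta m n → Submodule.Quotient.mk (x * a) = eta m (op a • n)
  eta_balanced : ∀ (b : S) (m : X) (n : Y), eta (op b • m) n = eta m (b • n)
  rho_add_left : ∀ (n n' : Y) (m : X), rho (n + n') m = rho n m + rho n' m
  rho_add_right : ∀ (n : Y) (m m' : X), rho n (m + m') = rho n m + rho n m'
  rho_smul_left : ∀ (b : S) (n : Y) (m : X), rho (b • n) m = b • rho n m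
  rho_smul_right : ∀ (b : S) (n : Y) (m : X) (y : S),
      Submodule.Quotient.mk y = rho n m → Submodule.Quotient.mk (y * b) = rho n (op b • m)
  rho_balanced : ∀ (a : R) (n : Y) (m : X), rho (op a • n) m = rho n (a • m)
  assoc_X : ∀ (m : X) (n : Y) (m' : X) (x : R) (b : S),
      Submodule.Quotient.mk x = eta m n → Submodule.Quotient.mk b = rho n m' →
        x • m' = op b • m
  assoc_Y : ∀ (n : Y) (m : X) (n' : Y) (b : S) (x : R),
      Submodule.Quotient.mk b = rho n m → Submodule.Quotient.mk x = eta m n' →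
        b • n' = op x • n

variable {I : Ideal R} {J : Ideal S} {eta : X → Y → R ⧸ I} {rho : Y → X → S ⧸ J}

theorem MCtx.symm (C : MCtx I J eta rho) : MCtx J I rho eta where
  Xann := C.YannS
  Yann := C.XannS
  XannS := C.Yann
  YannS := C.Xann
  eta_add_left := C.rho_add_left
  eta_add_right := C.rho_add_right
  eta_smul_left := C.rho_smul_left
  eta_smul_right := C.rho_smul_right
  eta_balanced := C.rho_balanced
  rho_add_left := C.eta_add_left
  rho_add_right := C.eta_add_right
  rho_smul_left := C.eta_smul_left
  rho_smul_right := C.eta_smul_right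
  rho_balanced := C.eta_balanced
  assoc_X := C.assoc_Y
  assoc_Y := C.assoc_X

section

variable {W : Type u} [AddCommGroup W] [Module S W]

theorem ann_congr (hW : ∀ b ∈ J, ∀ w : W, b • w = 0) {b c : S}
    (h : (Submodule.Quotient.mk b : S ⧸ J) = Submodule.Quotient.mk c) (w : W) :
    b • w = c • w := by
  have := hW _ ((Submodule.Quotient.eq J).1 h) w
  rwa [sub_smul, sub_eq_zero] at this

/-- The map `n ↦ ρ(n, m) w`. -/
noncomputable def MCtx.br (C : MCtx I J eta rho) (hW : ∀ b ∈ J, ∀ w : W, b • w = 0)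
    (m : X) (w : W) : Y →ₗ[S] W where
  toFun n := (Quotient.out (rho n m) : S) • w
  map_add' n n' := by
    rw [← add_smul]
    apply ann_congr hW
    rw [Submodule.Quotient.mk_add]
    simp only [Submodule.Quotient.mk, Quotient.out_eq]
    exact C.rho_add_left n n' m
  map_smul' b n := by
    rw [RingHom.id_apply, ← mul_smul]
    apply ann_congr hW
    rw [← smul_eq_mul, Submodule.Quotient.mk_smul]
    simp only [Submodule.Quotient.mk, Quotient.out_eq]
    exact C.rho_smul_left b n m

theorem MCtx.br_apply (C : MCtx I J eta rho) (hW : ∀ b ∈ J, ∀ w : W, b • w = 0)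
    (m : X) (w : W) (n : Y) (b : S) (h : Submodule.Quotient.mk b = rho n m) :
    C.br hW m w n = b • w := by
  apply ann_congr hW
  rw [h]
  exact Quotient.out_eq _

theorem MCtx.br_add_right (C : MCtx I J eta rho) (hW : ∀ b ∈ J, ∀ w : W, b • w = 0)
    (m : X) (w w' : W) : C.br hW m (w + w') = C.br hW m w + C.br hW m w' := by
  ext n
  obtain ⟨b, hb⟩ := Submodule.Quotient.mk_surjective J (rho n m)
  simp [C.br_apply hW _ _ _ _ hb]

theorem MCtx.br_zero_right (C : MCtx I J eta rho) (hW : ∀ b ∈ J, ∀ w : W, b • w = 0)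
    (m : X) : C.br hW m 0 = 0 := by
  ext n
  obtain ⟨b, hb⟩ := Submodule.Quotient.mk_surjective J (rho n m)
  simp [C.br_apply hW _ _ _ _ hb]

theorem MCtx.br_smul_right (C : MCtx I J eta rho) (hW : ∀ b ∈ J, ∀ w : W, b • w = 0)
    (m : X) (c : S) (w : W) : C.br hW m (c • w) = C.br hW (op c • m) w := by
  ext n
  obtain ⟨b, hb⟩ := Submodule.Quotient.mk_surjective J (rho n m)
  rw [C.br_apply hW _ _ _ _ hb, C.br_apply hW _ _ _ _ (C.rho_smul_right c n m b hb), mul_smul]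

theorem MCtx.smul_br (C : MCtx I J eta rho) (hW : ∀ b ∈ J, ∀ w : W, b • w = 0)
    (m : X) (a : R) (w : W) : a • C.br hW m w = C.br hW (a • m) w := by
  ext n
  rw [domSMul_apply]
  obtain ⟨b, hb⟩ := Submodule.Quotient.mk_surjective J (rho n (a • m))
  rw [C.br_apply hW _ _ _ _ hb]
  apply C.br_apply hW
  rw [hb, C.rho_balanced]

/-- `η(m,n) ψ = [m, ψ n]`. -/
theorem MCtx.eta_smul (C : MCtx I J eta rho) (hW : ∀ b ∈ J, ∀ w : W, b • w = 0)
    (m : X) (n : Y) (x : R) (hx : Submodule.Quotient.mk x = eta m n) (ψ : Y →ₗ[S] W) :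
    x • ψ = C.br hW m (ψ n) := by
  ext n'
  obtain ⟨b, hb⟩ := Submodule.Quotient.mk_surjective J (rho n' m)
  rw [C.br_apply hW _ _ _ _ hb, domSMul_apply, ← C.assoc_Y n' m n b x hb hx, map_smul]

variable (R W) in
/-- The abstract form of `Dmod`. -/
def Dabs (rho : Y → X → S ⧸ J) : Submodule R (Y →ₗ[S] W) :=
  Submodule.span R {ψ : Y →ₗ[S] W | ∃ (m : X) (w : W),
    ∀ (n : Y) (b : S), Submodule.Quotient.mk b = rho n m → ψ n = b • w}

theorem MCtx.br_mem (C : MCtx I J eta rho) (hW : ∀ b ∈ J, ∀ w : W, b • w = 0)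
    (m : X) (w : W) : C.br hW m w ∈ Dabs R W rho :=
  Submodule.subset_span ⟨m, w, fun n b h => C.br_apply hW m w n b h⟩

theorem MCtx.Dabs_le (C : MCtx I J eta rho) (hW : ∀ b ∈ J, ∀ w : W, b • w = 0)
    (P : Submodule R (Y →ₗ[S] W)) (h : ∀ m w, C.br hW m w ∈ P) : Dabs R W rho ≤ P := by
  refine Submodule.span_le.2 ?_
  rintro ψ ⟨m, w, hψ⟩
  have : ψ = C.br hW m w := by
    ext n
    obtain ⟨b, hb⟩ := Submodule.Quotient.mk_surjective J (rho n m)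
    rw [C.br_apply hW _ _ _ _ hb, hψ n b hb]
  rw [this]
  exact h m w

theorem simple_mem_of_ne {P : Submodule S W} [IsSimpleModule S W] {w : W} (hw : w ∈ P)
    (h0 : w ≠ 0) (w' : W) : w' ∈ P := by
  rcases eq_bot_or_eq_top P with h | h
  · rw [h, Submodule.mem_bot] at hw
    exact absurd hw h0
  · rw [h]; trivial

/-- Every nonzero submodule of `Hom(N, W)` contains `D W`. -/
theorem MCtx.Dabs_le_of_ne (C : MCtx I J eta rho) (hW : ∀ b ∈ J, ∀ w : W, b • w = 0)
    [IsSimpleModule S W] (P : Submodule R (Y →ₗ[S] W)) (ψ : Y →ₗ[S] W) (hψ : ψ ∈ P)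
    (h0 : ψ ≠ 0) : Dabs R W rho ≤ P := by
  apply C.Dabs_le hW
  intro m w
  obtain ⟨n, hn⟩ : ∃ n, ψ n ≠ 0 := by
    by_contra! h
    exact h0 (LinearMap.ext h)
  have hw := simple_mem_of_ne (Submodule.mem_span_singleton_self (R := S) (ψ n)) hn w
  obtain ⟨c, rfl⟩ := Submodule.mem_span_singleton.1 hw
  obtain ⟨x, hx⟩ := Submodule.Quotient.mk_surjective I (eta (op c • m) n)
  rw [C.br_smul_right, ← C.eta_smul hW _ _ _ hx]
  exact P.smul_mem _ hψ

theorem MCtx.exists_br_ne (C : MCtx I J eta rho) (hW : ∀ b ∈ J, ∀ w : W, b • w = 0)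
    [IsSimpleModule S W] (hne : ∃ m w, C.br hW m w ≠ 0) (w : W) (hw : w ≠ 0) :
    ∃ m, C.br hW m w ≠ 0 := by
  by_contra! h
  obtain ⟨m, w', hmw⟩ := hne
  let P : Submodule S W :=
    { carrier := {w | ∀ m, C.br hW m w = 0}
      add_mem' := by
        intro a b ha hb m
        rw [C.br_add_right, ha, hb, add_zero]
      zero_mem' := fun m => C.br_zero_right hW m
      smul_mem' := by
        intro c x hx m
        rw [C.br_smul_right]
        exact hx _ }
  exact hmw (simple_mem_of_ne (P := P) h hw w' m)

theorem MCtx.simple (C : MCtx I J eta rho) (hW : ∀ b ∈ J, ∀ w : W, b • w = 0)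
    [IsSimpleModule S W] (hne : ∃ m w, C.br hW m w ≠ 0) :
    IsSimpleModule R (Dabs R W rho) := by
  rw [isSimpleModule_iff_isAtom]
  obtain ⟨m, w, hmw⟩ := hne
  constructor
  · intro h
    have := C.br_mem hW m w
    rw [h, Submodule.mem_bot] at this
    exact hmw this
  · intro P hP
    by_contra h
    obtain ⟨ψ, hψ, h0⟩ := P.ne_bot_iff.1 h
    exact not_le_of_gt hP (C.Dabs_le_of_ne hW P ψ hψ h0)

theorem MCtx.Dabs_ann (C : MCtx I J eta rho) (a : R) (ha : a ∈ I) (ψ : Dabs R W rho) :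
    a • ψ = 0 := by
  ext n
  show (a • (ψ : Y →ₗ[S] W)) n = 0
  rw [domSMul_apply, C.Yann a ha, map_zero]

theorem MCtx.exists_eta_ne (C : MCtx I J eta rho) (hW : ∀ b ∈ J, ∀ w : W, b • w = 0)
    [IsSimpleModule S W] (hne : ∃ m w, C.br hW m w ≠ 0) :
    ∃ (m : X) (n : Y) (x : R) (ψ : Dabs R W rho),
      Submodule.Quotient.mk x = eta m n ∧ x • ψ ≠ 0 := by
  have hne' := hne
  obtain ⟨m, w, hmw⟩ := hne
  obtain ⟨n, hn⟩ : ∃ n, C.br hW m w n ≠ 0 := by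
    by_contra! h
    exact hmw (LinearMap.ext h)
  obtain ⟨m', hm'⟩ := C.exists_br_ne hW hne' _ hn
  obtain ⟨x, hx⟩ := Submodule.Quotient.mk_surjective I (eta m' n)
  refine ⟨m', n, x, ⟨_, C.br_mem hW m w⟩, hx, fun h => hm' ?_⟩
  rw [← C.eta_smul hW _ _ _ hx]
  exact congrArg Subtype.val h

/-- Isomorphism `D W ≅ D W'` induces `W ≅ W'`. -/
theorem MCtx.inj (C : MCtx I J eta rho) {W' : Type u} [AddCommGroup W'] [Module S W']
    (hW : ∀ b ∈ J, ∀ w : W, b • w = 0) (hW' : ∀ b ∈ J, ∀ w : W', b • w = 0)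
    [IsSimpleModule S W] [IsSimpleModule S W']
    (hne : ∃ m w, C.br hW m w ≠ 0) (hne' : ∃ m w, C.br hW' m w ≠ 0)
    (f : Dabs R W rho ≃ₗ[R] Dabs R W' rho) : Nonempty (W ≃ₗ[S] W') := by
  let D (m : X) (w : W) : Dabs R W rho := ⟨_, C.br_mem hW m w⟩
  let D' (m : X) (w : W') : Dabs R W' rho := ⟨_, C.br_mem hW' m w⟩
  have Dadd : ∀ m w w', D m (w + w') = D m w + D m w' := fun m w w' =>
    Subtype.ext (C.br_add_right hW m w w')
  have Dadd' : ∀ m w w', D' m (w + w') = D' m w + D' m w' := fun m w w' =>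
    Subtype.ext (C.br_add_right hW' m w w')
  have Dz : ∀ m, D m 0 = 0 := fun m => Subtype.ext (C.br_zero_right hW m)
  have Dz' : ∀ m, D' m 0 = 0 := fun m => Subtype.ext (C.br_zero_right hW' m)
  have Ds : ∀ m c w, D m (c • w) = D (op c • m) w := fun m c w =>
    Subtype.ext (C.br_smul_right hW m c w)
  have Ds' : ∀ m c w, D' m (c • w) = D' (op c • m) w := fun m c w =>
    Subtype.ext (C.br_smul_right hW' m c w)
  have D0 : ∀ w, (∀ m, D m w = 0) → w = 0 := by
    intro w h
    by_contra hw
    obtain ⟨m, hm⟩ := C.exists_br_ne hW hne w hw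
    exact hm (congrArg Subtype.val (h m))
  have D0' : ∀ w, (∀ m, D' m w = 0) → w = 0 := by
    intro w h
    by_contra hw
    obtain ⟨m, hm⟩ := C.exists_br_ne hW' hne' w hw
    exact hm (congrArg Subtype.val (h m))
  let G : Submodule S (W × W') :=
    { carrier := {p | ∀ m, f (D m p.1) = D' m p.2}
      add_mem' := by
        intro p q hp hq m
        show f (D m (p.1 + q.1)) = D' m (p.2 + q.2)
        rw [Dadd, Dadd', map_add, hp, hq]
      zero_mem' := by
        intro m
        show f (D m 0) = D' m 0
        rw [Dz, Dz', map_zero]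
      smul_mem' := by
        intro c p hp m
        show f (D m (c • p.1)) = D' m (c • p.2)
        rw [Ds, Ds', hp] }
  have hG : ∀ (ψ : Dabs R W rho) (n : Y), ((ψ.1 n, (f ψ).1 n) : W × W') ∈ G := by
    intro ψ n m
    obtain ⟨x, hx⟩ := Submodule.Quotient.mk_surjective I (eta m n)
    have h1 : x • ψ = D m (ψ.1 n) := Subtype.ext (C.eta_smul hW _ _ _ hx ψ.1)
    have h2 : x • f ψ = D' m ((f ψ).1 n) := Subtype.ext (C.eta_smul hW' _ _ _ hx (f ψ).1)
    show f (D m (ψ.1 n)) = D' m ((f ψ).1 n)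
    rw [← h1, ← h2, map_smul]
  let p1 : G →ₗ[S] W := (LinearMap.fst S W W').comp G.subtype
  let p2 : G →ₗ[S] W' := (LinearMap.snd S W W').comp G.subtype
  have i1 : Function.Injective p1 := by
    rw [← LinearMap.ker_eq_bot, LinearMap.ker_eq_bot']
    rintro ⟨⟨w, w'⟩, hp⟩ h
    have h : w = 0 := h
    subst h
    have : w' = 0 := by
      apply D0'
      intro m
      have := hp m
      simp only [Dz, map_zero] at this
      exact this.symm
    subst this
    rfl
  have i2 : Function.Injective p2 := by
    rw [← LinearMap.ker_eq_bot, LinearMap.ker_eq_bot']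
    rintro ⟨⟨w, w'⟩, hp⟩ h
    have h : w' = 0 := h
    subst h
    have : w = 0 := by
      apply D0
      intro m
      have := hp m
      simp only [Dz'] at this
      exact (LinearEquiv.map_eq_zero_iff f).1 this
    subst this
    rfl
  obtain ⟨m, w, hmw⟩ := hne
  obtain ⟨n, hn⟩ : ∃ n, C.br hW m w n ≠ 0 := by
    by_contra! h
    exact hmw (LinearMap.ext h)
  let g : G := ⟨_, hG (D m w) n⟩
  have g1 : p1 g ≠ 0 := hn
  have g0 : g ≠ 0 := fun h => g1 (by rw [h, map_zero])
  have g2 : p2 g ≠ 0 := fun h => g0 (i2 (by rw [h, map_zero]))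
  have s1 : Function.Surjective p1 := fun w =>
    simple_mem_of_ne (P := LinearMap.range p1) ⟨g, rfl⟩ g1 w
  have s2 : Function.Surjective p2 := fun w =>
    simple_mem_of_ne (P := LinearMap.range p2) ⟨g, rfl⟩ g2 w
  exact ⟨(LinearEquiv.ofBijective p1 ⟨i1, s1⟩).symm.trans (LinearEquiv.ofBijective p2 ⟨i2, s2⟩)⟩

/-- `W ≅ W'` induces `D W ≅ D W'`. -/
theorem MCtx.functor (C : MCtx I J eta rho) {W' : Type u} [AddCommGroup W'] [Module S W']
    (hW : ∀ b ∈ J, ∀ w : W, b • w = 0) (hW' : ∀ b ∈ J, ∀ w : W', b • w = 0)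
    (g : W ≃ₗ[S] W') : Nonempty (Dabs R W rho ≃ₗ[R] Dabs R W' rho) := by
  let T : (Y →ₗ[S] W) ≃ₗ[R] (Y →ₗ[S] W') :=
    { toFun := fun ψ => g.toLinearMap.comp ψ
      invFun := fun ψ => g.symm.toLinearMap.comp ψ
      map_add' := fun ψ φ => by ext n; simp
      map_smul' := fun a ψ => by ext n; simp [domSMul_apply]
      left_inv := fun ψ => by ext n; simp
      right_inv := fun ψ => by ext n; simp }
  have hT : ∀ m w, T (C.br hW m w) = C.br hW' m (g w) := by
    intro m w
    ext n
    obtain ⟨b, hb⟩ := Submodule.Quotient.mk_surjective J (rho n m)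
    show g (C.br hW m w n) = _
    rw [C.br_apply hW _ _ _ _ hb, C.br_apply hW' _ _ _ _ hb, map_smul]
  have : (Dabs R W rho).map (T : (Y →ₗ[S] W) →ₗ[R] (Y →ₗ[S] W')) = Dabs R W' rho := by
    apply le_antisymm
    · rw [Submodule.map_le_iff_le_comap]
      apply C.Dabs_le hW
      intro m w
      show T (C.br hW m w) ∈ Dabs R W' rho
      rw [hT]
      exact C.br_mem hW' _ _
    · apply C.Dabs_le hW'
      intro m w
      refine ⟨_, C.br_mem hW m (g.symm w), ?_⟩
      show T _ = _
      rw [hT, g.apply_symm_apply]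
  exact ⟨(T.submoduleMap _).trans (LinearEquiv.ofEq _ _ this)⟩

end

theorem MCtx.equiv_of_map (C : MCtx I J eta rho) {V W : Type u} [AddCommGroup V] [Module R V]
    [AddCommGroup W] [Module S W] [IsSimpleModule R V] [IsSimpleModule S W]
    (hW : ∀ b ∈ J, ∀ w : W, b • w = 0) (hne : ∃ m w, C.br hW m w ≠ 0)
    (f : V →ₗ[R] (Y →ₗ[S] W)) (hmem : ∀ u, f u ∈ Dabs R W rho) (u : V) (hu : f u ≠ 0) :
    Nonempty (V ≃ₗ[R] Dabs R W rho) := by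
  have hDs : IsSimpleModule R (Dabs R W rho) := C.simple hW hne
  let f' : V →ₗ[R] Dabs R W rho := f.codRestrict _ hmem
  have hf' : f' ≠ 0 := by
    intro h
    exact hu (congrArg Subtype.val (LinearMap.congr_fun h u))
  have hbij : Function.Bijective f' := LinearMap.bijective_of_ne_zero hf'
  exact ⟨LinearEquiv.ofBijective f' hbij⟩

/-- Every suitable simple `V` is `D (E V)`. -/
theorem MCtx.surj (C : MCtx I J eta rho) {V : Type u} [AddCommGroup V] [Module R V]
    (hV : ∀ a ∈ I, ∀ v : V, a • v = 0) [IsSimpleModule R V]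
    (hne : ∃ m n x, ∃ v : V, Submodule.Quotient.mk x = eta m n ∧ x • v ≠ 0) :
    ∃ (W : Type u) (_ : AddCommGroup W) (_ : Module S W)
      (hW : ∀ b ∈ J, ∀ w : W, b • w = 0), IsSimpleModule S W ∧ (∃ m w, C.br hW m w ≠ 0) ∧
      Nonempty (V ≃ₗ[R] Dabs R W rho) := by
  obtain ⟨m, n, x, v, hx, hxv⟩ := hne
  have hne : ∃ n v, C.symm.br hV n v ≠ 0 := by
    refine ⟨n, v, fun h => hxv ?_⟩
    rw [← C.symm.br_apply hV n v m x hx, h]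
    rfl
  have hW : ∀ b ∈ J, ∀ w : ↥(Dabs S V eta), b • w = 0 := fun b hb w => C.symm.Dabs_ann b hb w
  have hWs : IsSimpleModule S ↥(Dabs S V eta) := C.symm.simple hV hne
  let E (n : Y) (v : V) : ↥(Dabs S V eta) := ⟨_, C.symm.br_mem hV n v⟩
  let f : V →ₗ[R] (Y →ₗ[S] ↥(Dabs S V eta)) :=
    { toFun := fun v =>
        { toFun := fun n => E n v
          map_add' := by
            intro n n'
            apply Subtype.ext
            ext m
            obtain ⟨a, ha⟩ := Submodule.Quotient.mk_surjective I (eta m n)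
            obtain ⟨a', ha'⟩ := Submodule.Quotient.mk_surjective I (eta m n')
            show C.symm.br hV (n + n') v m = C.symm.br hV n v m + C.symm.br hV n' v m
            rw [C.symm.br_apply hV _ _ _ _ ha, C.symm.br_apply hV _ _ _ _ ha',
              C.symm.br_apply hV _ _ _ (a + a'), add_smul]
            rw [Submodule.Quotient.mk_add, ha, ha', C.eta_add_right]
          map_smul' := by
            intro b n
            apply Subtype.ext
            exact (C.symm.smul_br hV n b v).symm }
      map_add' := by
        intro v v'
        ext1 n
        exact Subtype.ext (C.symm.br_add_right hV n v v')
      map_smul' := by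
        intro a v
        ext1 n
        exact Subtype.ext (C.symm.br_smul_right hV n a v) }
  have key : f (x • v) = C.br hW m (E n v) := by
    ext1 n'
    obtain ⟨b, hb⟩ := Submodule.Quotient.mk_surjective J (rho n' m)
    rw [C.br_apply hW _ _ _ _ hb]
    apply Subtype.ext
    show C.symm.br hV n' (x • v) = b • C.symm.br hV n v
    rw [C.symm.eta_smul hV _ _ _ hb, C.symm.br_apply hV _ _ _ _ hx]
  have hfne : f (x • v) ≠ 0 := by
    obtain ⟨n', hn'⟩ := C.symm.exists_br_ne hV hne _ hxv
    intro h
    exact hn' (congrArg Subtype.val (LinearMap.congr_fun h n'))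
  have hWne : ∃ m w, C.br hW m w ≠ 0 := ⟨m, E n v, key ▸ hfne⟩
  refine ⟨↥(Dabs S V eta), inferInstance, inferInstance, hW, hWs, hWne, ?_⟩
  have hmem : ∀ u, f u ∈ Dabs R ↥(Dabs S V eta) rho := by
    intro u
    refine simple_mem_of_ne (P := (Dabs R ↥(Dabs S V eta) rho).comap f) (w := x • v) ?_ hxv u
    show f (x • v) ∈ Dabs R ↥(Dabs S V eta) rho
    rw [key]
    exact C.br_mem hW _ _
  exact C.equiv_of_map hW hWne f hmem (x • v) hfne

end MoritaHelpers

section LevelHelpers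

variable {Q : Type v} [PartialOrder Q] {R : Type u} [Ring R]

/-- `V` lives at level `l`. -/
def AtLevel (F : Q → Ideal R) (l : Q) (V : Type u) [AddCommGroup V] [Module R V] : Prop :=
  (∀ a ∈ lessIdeal R F l, ∀ v : V, a • v = 0) ∧ ∃ a ∈ F l, ∃ v : V, a • v ≠ 0

theorem AtLevel.congr {F : Q → Ideal R} {l : Q} {V V' : Type u} [AddCommGroup V] [Module R V]
    [AddCommGroup V'] [Module R V'] (e : V ≃ₗ[R] V') (h : AtLevel F l V) : AtLevel F l V' := by
  obtain ⟨h1, a, ha, v, hv⟩ := h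
  refine ⟨fun a ha v => ?_, a, ha, e v, ?_⟩
  · rw [← e.apply_symm_apply v, ← map_smul, h1 a ha, map_zero]
  · rw [← map_smul]
    exact fun h => hv ((LinearEquiv.map_eq_zero_iff e).1 h)

theorem iSup_ann {F : Q → Ideal R} (s : Set Q) {V : Type u} [AddCommGroup V] [Module R V] (v : V)
    (h : ∀ l ∈ s, ∀ a ∈ F l, a • v = 0) (a : R) (ha : a ∈ ⨆ l ∈ s, F l) : a • v = 0 := by
  have : (⨆ l ∈ s, F l) ≤ LinearMap.ker (LinearMap.toSpanSingleton R V v) :=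
    iSup₂_le fun l hl a ha => h l hl a ha
  exact this ha

theorem AtLevel.unique {F : Q → Ideal R} {l l' : Q} {V : Type u} [AddCommGroup V] [Module R V]
    [IsSimpleModule R V]
    (hFtwo : ∀ l : Q, ∀ a ∈ F l, ∀ b : R, a * b ∈ F l)
    (hFprod : ∀ l m : Q, ∀ a ∈ F l, ∀ b ∈ F m,
      a * b ∈ ⨆ ν ∈ {ν : Q | ν ≤ l ∧ ν ≤ m}, F ν)
    (h : AtLevel F l V) (h' : AtLevel F l' V) : l = l' := by
  obtain ⟨h1, a, ha, v, hv⟩ := h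
  obtain ⟨h1', a', ha', v', hv'⟩ := h'
  have hless : ∀ (k ν : Q), ν < k → F ν ≤ lessIdeal R F k := fun k ν hν =>
    le_iSup₂_of_le (f := fun m (_ : m ∈ {m : Q | m < k}) => F m) ν hν le_rfl
  let P : Submodule R V :=
    { carrier := {v | ∀ a ∈ F l, a • v = 0}
      add_mem' := by
        intro x y hx hy a ha
        rw [smul_add, hx a ha, hy a ha, add_zero]
      zero_mem' := fun a _ => smul_zero a
      smul_mem' := by
        intro c x hx a ha
        rw [← mul_smul]
        exact hx _ (hFtwo l a ha c) }
  have : ∃ c ∈ F l, c • a' • v' ≠ 0 := by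
    by_contra! hc
    exact hv (simple_mem_of_ne (P := P) hc hv' v a ha)
  obtain ⟨c, hc, hcv⟩ := this
  by_contra hll
  apply hcv
  rw [← mul_smul]
  refine iSup_ann _ v' ?_ _ (hFprod l l' c hc a' ha')
  rintro ν ⟨hν, hν'⟩ b hb
  rcases hν.eq_or_lt with rfl | hlt
  · rcases hν'.eq_or_lt with rfl | hlt'
    · exact absurd rfl hll
    · exact h1' b (hless _ _ hlt' hb) v'
  · exact h1 b (hless _ _ hlt hb) v'

theorem AtLevel.exists [WellFoundedLT Q] (F : Q → Ideal R) (V : Type u) [AddCommGroup V]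
    [Module R V] [IsSimpleModule R V] (hFsum : (⨆ l : Q, F l) = ⊤) : ∃ l, AtLevel F l V := by
  have hex : {l | ∃ a ∈ F l, ∃ v : V, a • v ≠ 0}.Nonempty := by
    by_contra hne
    rw [Set.not_nonempty_iff_eq_empty, Set.eq_empty_iff_forall_notMem] at hne
    simp only [Set.mem_setOf_eq, not_exists, not_and, not_not] at hne
    haveI := IsSimpleModule.nontrivial R V
    obtain ⟨v, hv⟩ := exists_ne (0 : V)
    apply hv
    rw [← one_smul R v]
    refine iSup_ann (F := F) Set.univ v (fun l _ a ha => hne l a ha v) 1 ?_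
    simp [hFsum]
  obtain ⟨l, hl, hmin⟩ := WellFounded.has_min (wellFounded_lt (α := Q)) _ hex
  refine ⟨l, fun a ha v => ?_, hl⟩
  refine iSup_ann _ v (fun m hm b hb => ?_) a ha
  by_contra hb0
  exact hmin m ⟨b, hb, v, hb0⟩ hm

end LevelHelpers

/-- Let `Λ` be a well-founded partially ordered set and `A` a ring
equipped with a prestandard filter over a family of rings `{B_λ}`: an ideal filter
`{A^{≤λ}}` on `A`, two-sided ideals `B'_λ ⊆ B_λ`, and for each `λ` a Morita context
`(M_λ, N_λ, η_λ, ρ_λ)` between `A/A^{<λ}` and `B_λ/B'_λ` whose trace ideal in `A/A^{<λ}`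
is `A^{≤λ}/A^{<λ}`.  (Here `M_λ` is an `(A, B_λ)`-bimodule annihilated by `A^{<λ}` and
`B'_λ`, similarly `N_λ`, and the pairings `η_λ`, `ρ_λ` take values in the quotients
`A/A^{<λ}` and `B_λ/B'_λ`; bimodule-linearity over the quotient rings is expressed on
representatives.)  Then there is a bijection between the disjoint union over `λ ∈ Λ` of
the sets of isomorphism classes of simple left `B_λ`-modules `W` with `B'_λ•W = 0` and
`B''_λ•W = W`, and the set of isomorphism classes of simple left `A`-modules, sending
`(λ, W)` to `D_λ W`. -/
theorem prestandard_filter_simple_classification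
    [WellFoundedLT Λ]
    (F : Λ → Ideal A) (B' : ∀ l, Ideal (B l))
    (eta : ∀ l, M l → N l → A ⧸ lessIdeal A F l)
    (rho : ∀ l, N l → M l → B l ⧸ B' l)
    -- `{A^{≤λ}}` is an ideal filter by two-sided ideals
    (hFtwo : ∀ l : Λ, ∀ a ∈ F l, ∀ b : A, a * b ∈ F l)
    (hFmono : Monotone F)
    (hFsum : (⨆ l : Λ, F l) = ⊤)
    (hFprod : ∀ l m : Λ, ∀ a ∈ F l, ∀ b ∈ F m,
      a * b ∈ ⨆ ν ∈ {ν : Λ | ν ≤ l ∧ ν ≤ m}, F ν)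
    -- each `B'_λ` is a two-sided ideal of `B_λ`
    (hB'two : ∀ l : Λ, ∀ b ∈ B' l, ∀ c : B l, b * c ∈ B' l)
    -- `M_λ` and `N_λ` are modules over `A/A^{<λ}` and `B_λ/B'_λ`
    (hMann : ∀ l : Λ, ∀ a ∈ lessIdeal A F l, ∀ x : M l, a • x = 0)
    (hNann : ∀ l : Λ, ∀ a ∈ lessIdeal A F l, ∀ y : N l, op a • y = 0)
    (hMannB : ∀ l : Λ, ∀ b ∈ B' l, ∀ x : M l, op b • x = 0)
    (hNannB : ∀ l : Λ, ∀ b ∈ B' l, ∀ y : N l, b • y = 0)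
    -- `η_λ` is an `(A/A^{<λ})`-bimodule homomorphism `M_λ ⊗_{B_λ/B'_λ} N_λ → A/A^{<λ}`
    (heta_add_left : ∀ l (m m' : M l) (n : N l),
      eta l (m + m') n = eta l m n + eta l m' n)
    (heta_add_right : ∀ l (m : M l) (n n' : N l),
      eta l m (n + n') = eta l m n + eta l m n')
    (heta_smul_left : ∀ l (a : A) (m : M l) (n : N l),
      eta l (a • m) n = a • eta l m n)
    (heta_smul_right : ∀ l (a : A) (m : M l) (n : N l) (x : A),
      Submodule.Quotient.mk x = eta l m n →
        Submodule.Quotient.mk (x * a) = eta l m (op a • n))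
    (heta_balanced : ∀ l (b : B l) (m : M l) (n : N l),
      eta l (op b • m) n = eta l m (b • n))
    -- `ρ_λ` is a `(B_λ/B'_λ)`-bimodule homomorphism `N_λ ⊗_{A/A^{<λ}} M_λ → B_λ/B'_λ`
    (hrho_add_left : ∀ l (n n' : N l) (m : M l),
      rho l (n + n') m = rho l n m + rho l n' m)
    (hrho_add_right : ∀ l (n : N l) (m m' : M l),
      rho l n (m + m') = rho l n m + rho l n m')
    (hrho_smul_left : ∀ l (b : B l) (n : N l) (m : M l),
      rho l (b • n) m = b • rho l n m)
    (hrho_smul_right : ∀ l (b : B l) (n : N l) (m : M l) (y : B l),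
      Submodule.Quotient.mk y = rho l n m →
        Submodule.Quotient.mk (y * b) = rho l n (op b • m))
    (hrho_balanced : ∀ l (a : A) (n : N l) (m : M l),
      rho l (op a • n) m = rho l n (a • m))
    -- the associativity laws of the Morita context
    (hassoc_M : ∀ l (m : M l) (n : N l) (m' : M l) (x : A) (b : B l),
      Submodule.Quotient.mk x = eta l m n → Submodule.Quotient.mk b = rho l n m' →
        x • m' = op b • m)
    (hassoc_N : ∀ l (n : N l) (m : M l) (n' : N l) (b : B l) (x : A),
      Submodule.Quotient.mk b = rho l n m → Submodule.Quotient.mk x = eta l m n' →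
        b • n' = op x • n)
    -- the trace ideal of the Morita context in `A/A^{<λ}` is `A^{≤λ}/A^{<λ}`
    (htrace : ∀ l : Λ, Submodule.span A
        {x : A ⧸ lessIdeal A F l | ∃ (m : M l) (n : N l), x = eta l m n} =
      Submodule.map (lessIdeal A F l).mkQ (F l)) :
    ∃ e : (Σ l : Λ, Quotient (setoidB B' rho l)) ≃ Quotient (setoidA (A := A)),
      ∀ (l : Λ) (W : ModuleCat.{u} (B l))
        (h : IsSimpleModule (B l) W ∧ BAnn B' l W ∧ BFull B' rho l W),
        ∃ hD : IsSimpleModule A (ModuleCat.of A (↥(Dmod (A := A) B' rho l (W : Type u)))),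
          e ⟨l, Quotient.mk (setoidB B' rho l) ⟨W, h⟩⟩ =
            Quotient.mk (setoidA (A := A)) ⟨ModuleCat.of A (↥(Dmod (A := A) B' rho l (W : Type u))), hD⟩ := by
  have C : ∀ l, MCtx (lessIdeal A F l) (B' l) (eta l) (rho l) := fun l =>
    { Xann := hMann l, Yann := hNann l, XannS := hMannB l, YannS := hNannB l
      eta_add_left := heta_add_left l, eta_add_right := heta_add_right l
      eta_smul_left := heta_smul_left l, eta_smul_right := heta_smul_right l
      eta_balanced := heta_balanced l
      rho_add_left := hrho_add_left l, rho_add_right := hrho_add_right l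
      rho_smul_left := hrho_smul_left l, rho_smul_right := hrho_smul_right l
      rho_balanced := hrho_balanced l
      assoc_X := hassoc_M l, assoc_Y := hassoc_N l }
  have hle : ∀ l, lessIdeal A F l ≤ F l := fun l => iSup₂_le fun m hm => hFmono (le_of_lt hm)
  -- representatives of `η(m,n)` lie in `F l`
  have hetaF : ∀ l (m : M l) (n : N l) (x : A), Submodule.Quotient.mk x = eta l m n → x ∈ F l := by
    intro l m n x hx
    have : eta l m n ∈ Submodule.map (lessIdeal A F l).mkQ (F l) := by
      rw [← htrace]
      exact Submodule.subset_span ⟨m, n, rfl⟩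
    obtain ⟨y, hy, hyx⟩ := this
    rw [← hx] at hyx
    have := hle l ((Submodule.Quotient.eq _).1 hyx)
    have h2 := (F l).sub_mem hy this
    simpa using h2
  -- fullness means the bracket is nonzero
  have full1 : ∀ l (W : Type u) [AddCommGroup W] [Module (B l) W] [IsSimpleModule (B l) W]
      (hW : BAnn B' l W), BFull B' rho l W → ∃ m w, (C l).br hW m w ≠ 0 := by
    intro l W _ _ _ hW hfull
    by_contra! h
    have hr : ∀ n m (b : B l), Submodule.Quotient.mk b = rho l n m → ∀ w : W, b • w = 0 := by
      intro n m b hb w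
      rw [← (C l).br_apply hW m w n b hb, h]
      rfl
    have hall : ∀ y ∈ Submodule.span (B l)
        {y : B l ⧸ B' l | ∃ (n : N l) (m : M l), y = rho l n m},
        ∀ b : B l, Submodule.Quotient.mk b = y → ∀ w : W, b • w = 0 := by
      intro y hy
      induction hy using Submodule.span_induction with
      | mem y hy =>
        obtain ⟨n, m, rfl⟩ := hy
        exact fun b hb w => hr n m b hb w
      | zero =>
        intro b hb w
        exact hW b ((Submodule.Quotient.mk_eq_zero _).1 hb) w
      | add y z _ _ ihy ihz =>
        intro b hb w
        obtain ⟨c, hc⟩ := Submodule.Quotient.mk_surjective _ y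
        obtain ⟨d, hd⟩ := Submodule.Quotient.mk_surjective _ z
        have : b • w = (c + d) • w := by
          apply ann_congr hW
          rw [hb, Submodule.Quotient.mk_add, hc, hd]
        rw [this, add_smul, ihy c hc, ihz d hd, add_zero]
      | smul a y _ ihy =>
        intro b hb w
        obtain ⟨c, hc⟩ := Submodule.Quotient.mk_surjective _ y
        have : b • w = (a * c) • w := by
          apply ann_congr hW
          rw [hb, ← smul_eq_mul, Submodule.Quotient.mk_smul, hc]
        rw [this, mul_smul, ihy c hc, smul_zero]
    have hbot : (⊤ : Submodule (B l) W) = ⊥ := by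
      rw [← hfull, Submodule.span_eq_bot]
      rintro x ⟨b, hb, w, rfl⟩
      exact hall _ hb b rfl w
    exact top_ne_bot hbot
  have full2 : ∀ l (W : Type u) [AddCommGroup W] [Module (B l) W] [IsSimpleModule (B l) W]
      (hW : BAnn B' l W), (∃ m w, (C l).br hW m w ≠ 0) → BFull B' rho l W := by
    intro l W _ _ _ hW hne
    obtain ⟨m, w, hmw⟩ := hne
    obtain ⟨n, hn⟩ : ∃ n, (C l).br hW m w n ≠ 0 := by
      by_contra! h
      exact hmw (LinearMap.ext h)
    obtain ⟨b, hb⟩ := Submodule.Quotient.mk_surjective _ (rho l n m)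
    rw [(C l).br_apply hW m w n b hb] at hn
    unfold BFull
    rw [eq_top_iff]
    intro w' _
    have hb' : (Submodule.Quotient.mk b : B l ⧸ B' l) ∈ Submodule.span (B l)
        {y : B l ⧸ B' l | ∃ (n : N l) (m : M l), y = rho l n m} := by
      rw [hb]
      exact Submodule.subset_span ⟨n, m, rfl⟩
    have hmem : b • w ∈ Submodule.span (B l) {x : W | ∃ b : B l,
        (Submodule.Quotient.mk b ∈
          Submodule.span (B l) {y : B l ⧸ B' l | ∃ (n : N l) (m : M l), y = rho l n m}) ∧
        ∃ w : W, x = b • w} := Submodule.subset_span ⟨b, hb', w, rfl⟩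
    exact simple_mem_of_ne hmem hn w'
  have hsimple : ∀ (l : Λ) (W : ModuleCat.{u} (B l))
      (_ : IsSimpleModule (B l) W ∧ BAnn B' l W ∧ BFull B' rho l W),
      IsSimpleModule A (ModuleCat.of A (↥(Dmod (A := A) B' rho l (W : Type u)))) := by
    rintro l W ⟨h1, h2, h3⟩
    exact (C l).simple h2 (full1 l W h2 h3)
  have hlevel : ∀ (l : Λ) (W : ModuleCat.{u} (B l))
      (_ : IsSimpleModule (B l) W ∧ BAnn B' l W ∧ BFull B' rho l W),
      AtLevel F l (↥(Dmod (A := A) B' rho l (W : Type u))) := by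
    rintro l W ⟨h1, h2, h3⟩
    refine ⟨fun a ha ψ => (C l).Dabs_ann a ha ψ, ?_⟩
    obtain ⟨m, n, x, ψ, hx, hne⟩ := (C l).exists_eta_ne h2 (full1 l W h2 h3)
    exact ⟨x, hetaF l m n x hx, ψ, hne⟩
  let G : (Σ l : Λ, Quotient (setoidB B' rho l)) → Quotient (setoidA (A := A)) := fun p =>
    Quotient.lift (s := setoidB B' rho p.1)
      (fun W => Quotient.mk (setoidA (A := A))
        ⟨ModuleCat.of A (↥(Dmod (A := A) B' rho p.1 (W.1 : Type u))), hsimple p.1 W.1 W.2⟩)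
      (by
        rintro ⟨W, hW⟩ ⟨W', hW'⟩ ⟨g⟩
        exact Quotient.sound (s := setoidA (A := A)) ((C p.1).functor hW.2.1 hW'.2.1 g)) p.2
  have hG : Function.Bijective G := by
    constructor
    · rintro ⟨l, q⟩ ⟨l', q'⟩ h
      induction q using Quotient.inductionOn with | _ W
      induction q' using Quotient.inductionOn with | _ W'
      obtain ⟨W, hW⟩ := W
      obtain ⟨W', hW'⟩ := W'
      obtain ⟨f⟩ := Quotient.exact (s := setoidA (A := A)) h
      haveI := hsimple l' W' hW'
      have hll : l = l' := AtLevel.unique (V := ↥(Dmod (A := A) B' rho l' (W' : Type u)))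
        hFtwo hFprod ((hlevel l W hW).congr f) (hlevel l' W' hW')
      subst hll
      haveI := hW.1
      haveI := hW'.1
      congr 1
      exact Quotient.sound (s := setoidB B' rho l) ((C l).inj hW.2.1 hW'.2.1
        (full1 l W hW.2.1 hW.2.2) (full1 l W' hW'.2.1 hW'.2.2) f)
    · intro q
      induction q using Quotient.inductionOn with | _ V
      obtain ⟨V, hV⟩ := V
      obtain ⟨l, hl, a, ha, v, hv⟩ := AtLevel.exists F V hFsum
      have hne : ∃ m n x, ∃ v : V, Submodule.Quotient.mk x = eta l m n ∧ x • v ≠ 0 := by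
        by_contra! hcon
        have hall : ∀ y ∈ Submodule.span A
            {x : A ⧸ lessIdeal A F l | ∃ (m : M l) (n : N l), x = eta l m n},
            ∀ b : A, Submodule.Quotient.mk b = y → ∀ w : V, b • w = 0 := by
          intro y hy
          induction hy using Submodule.span_induction with
          | mem y hy =>
            obtain ⟨m, n, rfl⟩ := hy
            exact fun b hb w => hcon m n b w hb
          | zero =>
            intro b hb w
            exact hl b ((Submodule.Quotient.mk_eq_zero _).1 hb) w
          | add y z _ _ ihy ihz =>
            intro b hb w
            obtain ⟨c, hc⟩ := Submodule.Quotient.mk_surjective _ y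
            obtain ⟨d, hd⟩ := Submodule.Quotient.mk_surjective _ z
            have : b • w = (c + d) • w := by
              apply ann_congr hl
              rw [hb, Submodule.Quotient.mk_add, hc, hd]
            rw [this, add_smul, ihy c hc, ihz d hd, add_zero]
          | smul a y _ ihy =>
            intro b hb w
            obtain ⟨c, hc⟩ := Submodule.Quotient.mk_surjective _ y
            have : b • w = (a * c) • w := by
              apply ann_congr hl
              rw [hb, ← smul_eq_mul, Submodule.Quotient.mk_smul, hc]
            rw [this, mul_smul, ihy c hc, smul_zero]
        refine hv (hall (Submodule.Quotient.mk a) ?_ a rfl v)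
        rw [htrace]
        exact ⟨a, ha, rfl⟩
      obtain ⟨W, i1, i2, hW, hWs, hWne, ⟨e⟩⟩ := (C l).surj (V := V) hl hne
      refine ⟨⟨l, Quotient.mk (setoidB B' rho l)
        ⟨ModuleCat.of (B l) W, hWs, hW, full2 l W hW hWne⟩⟩, ?_⟩
      exact Quotient.sound (s := setoidA (A := A)) ⟨e.symm⟩
  exact ⟨Equiv.ofBijective G hG, fun l W h => ⟨hsimple l W h, rfl⟩⟩

end StandardFilter
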